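/- arXiv:math/0608296 — 2 statements merged into one kernel-verified Lean document; each statement's English description precedes it below -/
import Mathlib

section
/- Let 𝓜 ⊂ ℂ^{n+d} be a generic submanifold given near 0 by Im w = φ(z, z̄, s) with s = Re w and j^k_0 φ ∈ (J^k)_{nh}, and let L_j = ∂/∂z_j + i·φ_{z_j}(z,z̄,s)·(id − i·φ_s(z,z̄,s))^{−1}·∂/∂s for j = 1,…,n be the corresponding local basis of (1,0) vector fields on 𝓜 (φ_{z_j} viewed as a row vector in ℂ^d, φ_s as a d×d matrix, ∂/∂s as a column of the d vector fields ∂/∂s_1,…,∂/∂s_d). Then for all indices j_1,…,j_r,l ∈ {1,…,n} with r ≤ k−1, the iterated commutator satisfies [L_{j_1},[L_{j_2},…,[L_{j_r}, L̄_l]…]](0) = −2i·φ_{z_{j_1} z_{j_2} ⋯ z_{j_r} z̄_l}(0)·∂/∂s. -/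
noncomputable section

open Complex Topology Manifold Set Function

/-- `ℂ^N`, realized as functions `Fin N → ℂ`, viewed as a real normed space. -/
abbrev CSp (N : ℕ) := Fin N → ℂ
/-- `ℝ^m`, realized as functions `Fin m → ℝ`. -/
abbrev RSp (m : ℕ) := Fin m → ℝ

/-- The `j`-th standard basis vector of `ℂ^N`. -/
def cbasis (N : ℕ) (j : Fin N) : CSp N := fun i => if i = j then 1 else 0
/-- `√-1` times the `j`-th standard basis vector of `ℂ^N`. -/
def cbasisI (N : ℕ) (j : Fin N) : CSp N := fun i => if i = j then Complex.I else 0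

/-- The Wirtinger derivative `∂f/∂Z_j` at `q` of a function `f : ℂ^N → ℂ`
(viewed as real-differentiable). -/
def wZ {N : ℕ} (f : CSp N → ℂ) (q : CSp N) (j : Fin N) : ℂ :=
  (1 / 2 : ℂ) * (fderiv ℝ f q (cbasis N j) - Complex.I * fderiv ℝ f q (cbasisI N j))

/-- The Wirtinger derivative `∂f/∂Z̄_j` at `q`. -/
def wZbar {N : ℕ} (f : CSp N → ℂ) (q : CSp N) (j : Fin N) : ℂ :=
  (1 / 2 : ℂ) * (fderiv ℝ f q (cbasis N j) + Complex.I * fderiv ℝ f q (cbasisI N j))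

/-- The complex gradient `ρ_Z = (∂ρ/∂Z_1, …, ∂ρ/∂Z_N)` of a real-valued function `ρ`. -/
def cgrad {N : ℕ} (ρ : CSp N → ℝ) (q : CSp N) : CSp N :=
  fun j => wZ (fun z => (ρ z : ℂ)) q j

/-- The space `ℂ^n × ℝ^d` with coordinates `(z, s)`. -/
abbrev DSp (n d : ℕ) := (Fin n → ℂ) × (Fin d → ℝ)

/-- The basis vector `∂/∂x_j` of `ℂ^n × ℝ^d`. -/
def dez (n d : ℕ) (j : Fin n) : DSp n d := (fun i => if i = j then 1 else 0, 0)
/-- The basis vector `∂/∂y_j` of `ℂ^n × ℝ^d`. -/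
def dezI (n d : ℕ) (j : Fin n) : DSp n d := (fun i => if i = j then Complex.I else 0, 0)
/-- The basis vector `∂/∂s_t` of `ℂ^n × ℝ^d`. -/
def des (n d : ℕ) (t : Fin d) : DSp n d := (0, fun u => if u = t then 1 else 0)

/-- The Wirtinger derivative `∂f/∂z_j` of `f : ℂ^n × ℝ^d → ℂ`. -/
def dwZ {n d : ℕ} (j : Fin n) (f : DSp n d → ℂ) (q : DSp n d) : ℂ :=
  (1 / 2 : ℂ) * (fderiv ℝ f q (dez n d j) - Complex.I * fderiv ℝ f q (dezI n d j))
/-- The Wirtinger derivative `∂f/∂z̄_j`. -/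
def dwZbar {n d : ℕ} (j : Fin n) (f : DSp n d → ℂ) (q : DSp n d) : ℂ :=
  (1 / 2 : ℂ) * (fderiv ℝ f q (dez n d j) + Complex.I * fderiv ℝ f q (dezI n d j))
/-- The derivative `∂f/∂s_t`. -/
def dwS {n d : ℕ} (t : Fin d) (f : DSp n d → ℂ) (q : DSp n d) : ℂ :=
  fderiv ℝ f q (des n d t)

/-- Iterate a family of operators according to a multiindex. -/
def iterFin {α : Type*} (n : ℕ) (op : Fin n → α → α) (μ : Fin n → ℕ) (f : α) : α :=
  (List.finRange n).foldr (fun j g => (op j)^[μ j] g) f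

/-- The mixed Wirtinger derivative `∂^α_z ∂^β_z̄ ∂^γ_s f` of `f : ℂ^n × ℝ^d → ℂ`. -/
def mixedDeriv {n d : ℕ} (α β : Fin n → ℕ) (γ : Fin d → ℕ) (f : DSp n d → ℂ) :
    DSp n d → ℂ :=
  iterFin n (fun j g q => dwZ j g q) α
    (iterFin n (fun j g q => dwZbar j g q) β
      (iterFin d (fun t g q => dwS t g q) γ f))

/-- `j^k_0 φ ∈ (J^k)_{nh}`: the `k`-jet of `φ` at `0` is free of harmonic terms, i.e. all
mixed derivatives `∂^α_z ∂^β_z̄ ∂^γ_s φ(0)` of total order `≤ k` with `α = 0` or `β = 0`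
vanish. -/
def InJkNH (n d k : ℕ) (φ : DSp n d → Fin d → ℝ) : Prop :=
  ∀ (α β : Fin n → ℕ) (γ : Fin d → ℕ),
    (∑ i, α i) + (∑ i, β i) + (∑ t, γ t) ≤ k → (α = 0 ∨ β = 0) →
    ∀ j, mixedDeriv α β γ (fun q => (φ q j : ℂ)) 0 = 0

/-- The vector `φ_{z_r, z̄^α}(0) ∈ ℂ^d`. -/
def phiZVec {n d : ℕ} (φ : DSp n d → Fin d → ℝ) (r : Fin n) (α : Fin n → ℕ) : Fin d → ℂ :=
  fun j => mixedDeriv (fun i => if i = r then 1 else 0) α 0 (fun q => (φ q j : ℂ)) 0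

/-- The vector `φ_{z̄_r, z^α}(0) ∈ ℂ^d`. -/
def phiZbarVec {n d : ℕ} (φ : DSp n d → Fin d → ℝ) (r : Fin n) (α : Fin n → ℕ) :
    Fin d → ℂ :=
  fun j => mixedDeriv α (fun i => if i = r then 1 else 0) 0 (fun q => (φ q j : ℂ)) 0

/-- The graph `{Im w = φ(z, z̄, Re w)} ⊂ ℂ^{n+d}` of `φ`. -/
def graphSet (n d : ℕ) (φ : DSp n d → Fin d → ℝ) : Set (CSp (n + d)) :=
  {Z | ∀ t : Fin d, (Z (Fin.natAdd n t)).im =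
    φ (fun i => Z (Fin.castAdd d i), fun u => (Z (Fin.natAdd n u)).re) t}

/-- A complex vector field on (an open subset of) `ℂ^n × ℝ^d`, written as
`Σ a^j ∂/∂z_j + Σ b^j ∂/∂z̄_j + Σ c^t ∂/∂s_t`. -/
structure GVF (n d : ℕ) where
  a : DSp n d → Fin n → ℂ
  b : DSp n d → Fin n → ℂ
  c : DSp n d → Fin d → ℂ

/-- The action of such a vector field on a function. -/
def GVF.act {n d : ℕ} (v : GVF n d) (f : DSp n d → ℂ) (q : DSp n d) : ℂ :=
  (∑ j, v.a q j * dwZ j f q) + (∑ j, v.b q j * dwZbar j f q) + ∑ t, v.c q t * dwS t f q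

/-- The Lie bracket, computed coefficientwise. -/
def GVF.bracket {n d : ℕ} (v w : GVF n d) : GVF n d :=
  ⟨fun q j => v.act (fun z => w.a z j) q - w.act (fun z => v.a z j) q,
   fun q j => v.act (fun z => w.b z j) q - w.act (fun z => v.b z j) q,
   fun q t => v.act (fun z => w.c z t) q - w.act (fun z => v.c z t) q⟩

/-- Complex conjugation of vector fields. -/
def GVF.conj {n d : ℕ} (v : GVF n d) : GVF n d :=
  ⟨fun q j => starRingEnd ℂ (v.b q j), fun q j => starRingEnd ℂ (v.a q j),
   fun q t => starRingEnd ℂ (v.c q t)⟩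

/-- Iterated Lie bracket `[L_1, [L_2, …, [L_r, last]…]]`. -/
def nestGVF {n d : ℕ} (Ls : List (GVF n d)) (last : GVF n d) : GVF n d :=
  Ls.foldr GVF.bracket last

/-- The complexified matrix `φ_s(q) = (∂φ^t/∂s_u (q))`. -/
def phiSMat {n d : ℕ} (φ : DSp n d → Fin d → ℝ) (q : DSp n d) : Matrix (Fin d) (Fin d) ℂ :=
  fun t u => dwS u (fun x => (φ x t : ℂ)) q

/-- The `(1,0)` vector field
`L_j = ∂/∂z_j + i φ_{z_j}(z,z̄,s)·(id - i φ_s(z,z̄,s))⁻¹·∂/∂s` on the graph of `φ`. -/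
def graphLfield {n d : ℕ} (φ : DSp n d → Fin d → ℝ) (j : Fin n) : GVF n d :=
  ⟨fun _ i => if i = j then 1 else 0, fun _ _ => 0,
   fun q t => ∑ u, Complex.I * dwZ j (fun x => (φ x u : ℂ)) q *
     (1 - Complex.I • phiSMat φ q)⁻¹ u t⟩

section Wirtinger

variable {E : Type*} [NormedAddCommGroup E] [NormedSpace ℝ E]

/-- The complex first-order operator `c ∂_v + c' ∂_w` with constant coefficients. -/
def wirt (c c' : ℂ) (v w : E) (f : E → ℂ) (q : E) : ℂ :=
  c * fderiv ℝ f q v + c' * fderiv ℝ f q w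

/-- Smoothness of a complex-valued function at the origin. -/
abbrev SmoothAtZero (f : E → ℂ) : Prop := ContDiffAt ℝ ((⊤ : ℕ∞) : WithTop ℕ∞) f 0

theorem SmoothAtZero.eventually_differentiableAt {f : E → ℂ} (hf : SmoothAtZero f) :
    ∀ᶠ q in 𝓝 (0 : E), DifferentiableAt ℝ f q := by
  have h : ContDiffAt ℝ 1 f 0 := hf.of_le (by exact_mod_cast le_top)
  filter_upwards [h.eventually (by simp)] with q hq using hq.differentiableAt (by simp)

theorem SmoothAtZero.wirt {f : E → ℂ} (hf : SmoothAtZero f) (c c' : ℂ) (v w : E) :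
    SmoothAtZero (wirt c c' v w f) := by
  have h := hf.fderiv_right (m := ((⊤ : ℕ∞) : WithTop ℕ∞)) (by exact_mod_cast le_top)
  exact (contDiffAt_const.mul (h.clm_apply contDiffAt_const)).add
    (contDiffAt_const.mul (h.clm_apply contDiffAt_const))

theorem contDiff_wirt {f : E → ℂ} (hf : ContDiff ℝ ((⊤ : ℕ∞) : WithTop ℕ∞) f) (c c' : ℂ)
    (v w : E) : ContDiff ℝ ((⊤ : ℕ∞) : WithTop ℕ∞) (wirt c c' v w f) := by
  have h := hf.fderiv_right (m := ((⊤ : ℕ∞) : WithTop ℕ∞)) (by exact_mod_cast le_top)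
  exact (contDiff_const.mul (h.clm_apply contDiff_const)).add
    (contDiff_const.mul (h.clm_apply contDiff_const))

theorem wirt_congr {f g : E → ℂ} {q : E} (h : f =ᶠ[𝓝 q] g) (c c' : ℂ) (v w : E) :
    wirt c c' v w f =ᶠ[𝓝 q] wirt c c' v w g := by
  filter_upwards [h.fderiv (𝕜 := ℝ)] with x hx
  simp [wirt, hx]

theorem wirt_const (a c c' : ℂ) (v w q : E) : wirt c c' v w (fun _ => a) q = 0 := by
  simp [wirt]

theorem wirt_add {f g : E → ℂ} {q : E} (hf : DifferentiableAt ℝ f q)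
    (hg : DifferentiableAt ℝ g q) (c c' : ℂ) (v w : E) :
    wirt c c' v w (fun x => f x + g x) q = wirt c c' v w f q + wirt c c' v w g q := by
  simp only [wirt, fderiv_fun_add hf hg, add_apply]
  ring

theorem wirt_sum {ι : Type*} {s : Finset ι} {F : ι → E → ℂ} {q : E}
    (h : ∀ i ∈ s, DifferentiableAt ℝ (F i) q) (c c' : ℂ) (v w : E) :
    wirt c c' v w (fun x => ∑ i ∈ s, F i x) q = ∑ i ∈ s, wirt c c' v w (F i) q := by
  simp only [wirt, fderiv_fun_sum h, sum_apply, Finset.mul_sum,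
    Finset.sum_add_distrib]

theorem wirt_mul {f g : E → ℂ} {q : E} (hf : DifferentiableAt ℝ f q)
    (hg : DifferentiableAt ℝ g q) (c c' : ℂ) (v w : E) :
    wirt c c' v w (fun x => f x * g x) q
      = wirt c c' v w f q * g q + f q * wirt c c' v w g q := by
  simp only [wirt, fderiv_fun_mul hf hg, add_apply,
    smul_apply, smul_eq_mul]
  ring

theorem fderiv_wirt_apply {f : E → ℂ} (hf : ContDiff ℝ ((⊤ : ℕ∞) : WithTop ℕ∞) f)
    (c c' : ℂ) (v w q u : E) :
    fderiv ℝ (wirt c c' v w f) q u =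
      c * fderiv ℝ (fderiv ℝ f) q u v + c' * fderiv ℝ (fderiv ℝ f) q u w := by
  have h : DifferentiableAt ℝ (fderiv ℝ f) q :=
    ((hf.fderiv_right (m := ((⊤ : ℕ∞) : WithTop ℕ∞)) (by exact_mod_cast le_top)).differentiable
      (by simp)) q
  have key : ∀ x : E, HasFDerivAt (fun y => fderiv ℝ f y x)
      ((ContinuousLinearMap.apply ℝ ℂ x).comp (fderiv ℝ (fderiv ℝ f) q)) q := fun x =>
    (ContinuousLinearMap.apply ℝ ℂ x).hasFDerivAt.comp q h.hasFDerivAt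
  have := (((key v).const_mul c).add ((key w).const_mul c')).fderiv
  change fderiv ℝ ((fun y => c * fderiv ℝ f y v) + fun y => c' * fderiv ℝ f y w) q u = _
  rw [this]
  simp

theorem wirt_comm {f : E → ℂ} (hf : ContDiff ℝ ((⊤ : ℕ∞) : WithTop ℕ∞) f)
    (a a' b b' : ℂ) (v v' w w' : E) :
    wirt a a' v v' (wirt b b' w w' f) = wirt b b' w w' (wirt a a' v v' f) := by
  funext q
  have hs : ∀ x y, fderiv ℝ (fderiv ℝ f) q x y = fderiv ℝ (fderiv ℝ f) q y x := fun x y =>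
    (hf.contDiffAt.isSymmSndFDerivAt
      (by simpa using WithTop.coe_le_coe.mpr (le_top (a := (2 : ℕ∞))))) x y
  rw [wirt, wirt, fderiv_wirt_apply hf, fderiv_wirt_apply hf, fderiv_wirt_apply hf,
    fderiv_wirt_apply hf, hs v w, hs v w', hs v' w, hs v' w']
  ring

end Wirtinger

section Iterates

variable {α ι : Type*} {P : α → Prop}

theorem iterate_mem {D : α → α} (hD : ∀ f, P f → P (D f)) (m : ℕ) {f : α} (hf : P f) :
    P (D^[m] f) := by
  induction m with
  | zero => exact hf
  | succ m ih => rw [Function.iterate_succ_apply']; exact hD _ ih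

theorem iterate_comm_of {D D' : α → α} (hD' : ∀ f, P f → P (D' f))
    (hc : ∀ f, P f → D (D' f) = D' (D f)) (m : ℕ) {f : α} (hf : P f) :
    D (D'^[m] f) = D'^[m] (D f) := by
  induction m with
  | zero => rfl
  | succ m ih =>
    rw [Function.iterate_succ_apply', Function.iterate_succ_apply',
      hc _ (iterate_mem hD' m hf), ih]

theorem foldr_iterate_mem {op : ι → α → α} (hop : ∀ i f, P f → P (op i f)) (μ : ι → ℕ)
    (l : List ι) {f : α} (hf : P f) : P (l.foldr (fun j g => (op j)^[μ j] g) f) := by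
  induction l with
  | nil => exact hf
  | cons j l ih => exact iterate_mem (hop j) _ ih

theorem foldr_iterate_comm {op : ι → α → α} (hop : ∀ i f, P f → P (op i f)) {D : α → α}
    (hc : ∀ i f, P f → D (op i f) = op i (D f)) (μ : ι → ℕ) (l : List ι) {f : α} (hf : P f) :
    D (l.foldr (fun j g => (op j)^[μ j] g) f)
      = l.foldr (fun j g => (op j)^[μ j] g) (D f) := by
  induction l with
  | nil => rfl
  | cons j l ih =>
    rw [List.foldr_cons, List.foldr_cons,
      iterate_comm_of (hop j) (hc j) _ (foldr_iterate_mem hop μ l hf), ih]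

theorem foldr_iterate_succ [DecidableEq ι] {op : ι → α → α} (hop : ∀ i f, P f → P (op i f))
    (hc : ∀ i j f, P f → op i (op j f) = op j (op i f)) (μ : ι → ℕ) {l : List ι}
    (hl : l.Nodup) {i : ι} (hi : i ∈ l) {f : α} (hf : P f) :
    op i (l.foldr (fun j g => (op j)^[μ j] g) f)
      = l.foldr (fun j g => (op j)^[(μ + Pi.single i 1 : ι → ℕ) j] g) f := by
  induction l with
  | nil => simp at hi
  | cons j l ih =>
    rw [List.nodup_cons] at hl
    rw [List.foldr_cons, List.foldr_cons]
    rcases eq_or_ne i j with rfl | hij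
    · have htail : l.foldr (fun j g => (op j)^[(μ + Pi.single i 1 : ι → ℕ) j] g) f
          = l.foldr (fun j g => (op j)^[μ j] g) f := by
        refine List.foldr_ext _ _ _ fun a ha b => ?_
        have : a ≠ i := fun h => hl.1 (h ▸ ha)
        simp [this]
      rw [htail]
      simp [Function.iterate_succ_apply']
    · rw [iterate_comm_of (hop j) (hc i j) _ (foldr_iterate_mem hop μ l hf),
        ih hl.2 ((List.mem_cons.mp hi).resolve_left hij)]
      simp [hij.symm]

theorem iterFin_mem {n : ℕ} {op : Fin n → α → α} (hop : ∀ i f, P f → P (op i f))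
    (μ : Fin n → ℕ) {f : α} (hf : P f) : P (iterFin n op μ f) :=
  foldr_iterate_mem hop μ _ hf

theorem iterFin_comm {n : ℕ} {op : Fin n → α → α} (hop : ∀ i f, P f → P (op i f)) {D : α → α}
    (hc : ∀ i f, P f → D (op i f) = op i (D f)) (μ : Fin n → ℕ) {f : α} (hf : P f) :
    D (iterFin n op μ f) = iterFin n op μ (D f) :=
  foldr_iterate_comm hop hc μ _ hf

theorem iterFin_succ {n : ℕ} {op : Fin n → α → α} (hop : ∀ i f, P f → P (op i f))
    (hc : ∀ i j f, P f → op i (op j f) = op j (op i f)) (μ : Fin n → ℕ) (i : Fin n) {f : α}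
    (hf : P f) : op i (iterFin n op μ f) = iterFin n op (μ + Pi.single i 1) f :=
  foldr_iterate_succ hop hc μ (List.nodup_finRange n) (List.mem_finRange i) hf

theorem iterFin_zero {n : ℕ} (op : Fin n → α → α) (f : α) : iterFin n op 0 f = f := by
  unfold iterFin
  induction List.finRange n with
  | nil => rfl
  | cons j l => simp

end Iterates

section MixedDerivatives

variable {n d : ℕ}

theorem dwZ_eq_wirt (j : Fin n) (f : DSp n d → ℂ) :
    dwZ j f = wirt (1 / 2) (-(1 / 2) * Complex.I) (dez n d j) (dezI n d j) f := by
  funext q; simp only [dwZ, wirt]; ring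

theorem dwZbar_eq_wirt (j : Fin n) (f : DSp n d → ℂ) :
    dwZbar j f = wirt (1 / 2) (1 / 2 * Complex.I) (dez n d j) (dezI n d j) f := by
  funext q; simp only [dwZbar, wirt]; ring

theorem dwS_eq_wirt (t : Fin d) (f : DSp n d → ℂ) :
    dwS t f = wirt 1 0 (des n d t) 0 f := by
  funext q; simp [dwS, wirt]

/-- Global smoothness of a complex-valued function on `ℂ^n × ℝ^d`. -/
abbrev Smooth (f : DSp n d → ℂ) : Prop := ContDiff ℝ ((⊤ : ℕ∞) : WithTop ℕ∞) f

theorem smooth_dwZ (j : Fin n) (f : DSp n d → ℂ) (hf : Smooth f) : Smooth (dwZ j f) := by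
  rw [dwZ_eq_wirt]; exact contDiff_wirt hf _ _ _ _

theorem smooth_dwZbar (j : Fin n) (f : DSp n d → ℂ) (hf : Smooth f) :
    Smooth (dwZbar j f) := by
  rw [dwZbar_eq_wirt]; exact contDiff_wirt hf _ _ _ _

theorem smooth_dwS (t : Fin d) (f : DSp n d → ℂ) (hf : Smooth f) : Smooth (dwS t f) := by
  rw [dwS_eq_wirt]; exact contDiff_wirt hf _ _ _ _

theorem dwZ_dwZ_comm (i j : Fin n) (f : DSp n d → ℂ) (hf : Smooth f) :
    dwZ i (dwZ j f) = dwZ j (dwZ i f) := by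
  simp only [dwZ_eq_wirt]; exact wirt_comm hf _ _ _ _ _ _ _ _

theorem dwZbar_dwZ_comm (i j : Fin n) (f : DSp n d → ℂ) (hf : Smooth f) :
    dwZbar i (dwZ j f) = dwZ j (dwZbar i f) := by
  simp only [dwZ_eq_wirt, dwZbar_eq_wirt]; exact wirt_comm hf _ _ _ _ _ _ _ _

theorem dwS_dwZ_comm (t : Fin d) (j : Fin n) (f : DSp n d → ℂ) (hf : Smooth f) :
    dwS t (dwZ j f) = dwZ j (dwS t f) := by
  simp only [dwZ_eq_wirt, dwS_eq_wirt]; exact wirt_comm hf _ _ _ _ _ _ _ _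

theorem dwS_dwZbar_comm (t : Fin d) (j : Fin n) (f : DSp n d → ℂ) (hf : Smooth f) :
    dwS t (dwZbar j f) = dwZbar j (dwS t f) := by
  simp only [dwZbar_eq_wirt, dwS_eq_wirt]; exact wirt_comm hf _ _ _ _ _ _ _ _

theorem dwZbar_dwZbar_comm (i j : Fin n) (f : DSp n d → ℂ) (hf : Smooth f) :
    dwZbar i (dwZbar j f) = dwZbar j (dwZbar i f) := by
  simp only [dwZbar_eq_wirt]; exact wirt_comm hf _ _ _ _ _ _ _ _

theorem dwS_dwS_comm (t u : Fin d) (f : DSp n d → ℂ) (hf : Smooth f) :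
    dwS t (dwS u f) = dwS u (dwS t f) := by
  simp only [dwS_eq_wirt]; exact wirt_comm hf _ _ _ _ _ _ _ _

theorem mixedDeriv_zero (f : DSp n d → ℂ) : mixedDeriv 0 0 0 f = f := by
  simp only [mixedDeriv, iterFin_zero]

theorem smooth_mixedDeriv (α β : Fin n → ℕ) (γ : Fin d → ℕ) {f : DSp n d → ℂ}
    (hf : Smooth f) : Smooth (mixedDeriv α β γ f) :=
  iterFin_mem (P := Smooth) smooth_dwZ _ <| iterFin_mem (P := Smooth) smooth_dwZbar _ <|
    iterFin_mem (P := Smooth) smooth_dwS _ hf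

theorem dwZ_mixedDeriv (α β : Fin n → ℕ) (γ : Fin d → ℕ) {f : DSp n d → ℂ} (hf : Smooth f)
    (j : Fin n) : dwZ j (mixedDeriv α β γ f) = mixedDeriv (α + Pi.single j 1) β γ f :=
  iterFin_succ (P := Smooth) smooth_dwZ dwZ_dwZ_comm α j <|
    iterFin_mem (P := Smooth) smooth_dwZbar _ <| iterFin_mem (P := Smooth) smooth_dwS _ hf

theorem dwZbar_mixedDeriv (α β : Fin n → ℕ) (γ : Fin d → ℕ) {f : DSp n d → ℂ}
    (hf : Smooth f) (j : Fin n) :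
    dwZbar j (mixedDeriv α β γ f) = mixedDeriv α (β + Pi.single j 1) γ f := by
  have hS := iterFin_mem (P := Smooth) smooth_dwS γ hf
  refine (iterFin_comm (P := Smooth) smooth_dwZ (D := dwZbar j) (dwZbar_dwZ_comm j) α
    (iterFin_mem (P := Smooth) smooth_dwZbar β hS)).trans ?_
  exact congrArg (iterFin n _ α)
    (iterFin_succ (P := Smooth) smooth_dwZbar dwZbar_dwZbar_comm β j hS)

theorem dwS_mixedDeriv (α β : Fin n → ℕ) (γ : Fin d → ℕ) {f : DSp n d → ℂ}
    (hf : Smooth f) (t : Fin d) :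
    dwS t (mixedDeriv α β γ f) = mixedDeriv α β (γ + Pi.single t 1) f := by
  have hS := iterFin_mem (P := Smooth) smooth_dwS γ hf
  refine (iterFin_comm (P := Smooth) smooth_dwZ (D := dwS t) (dwS_dwZ_comm t) α
    (iterFin_mem (P := Smooth) smooth_dwZbar β hS)).trans ?_
  refine congrArg (iterFin n _ α) ?_
  refine (iterFin_comm (P := Smooth) smooth_dwZbar (D := dwS t) (dwS_dwZbar_comm t) β
    hS).trans ?_
  exact congrArg (iterFin n _ β)
    (iterFin_succ (P := Smooth) smooth_dwS dwS_dwS_comm γ t hf)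

theorem foldr_dwZ_dwZbar {f : DSp n d → ℂ} (hf : Smooth f) (l : Fin n) (js : List (Fin n)) :
    js.foldr dwZ (dwZbar l f) = mixedDeriv (fun i => js.count i) (Pi.single l 1) 0 f := by
  induction js with
  | nil =>
    have := dwZbar_mixedDeriv 0 0 0 hf l
    rw [mixedDeriv_zero, zero_add] at this
    exact this
  | cons j js ih =>
    rw [List.foldr_cons, ih, dwZ_mixedDeriv _ _ _ hf]
    congr 1
    funext i
    simp [List.count_cons, Pi.single_apply, eq_comm (a := i)]

end MixedDerivatives

section Flatness

variable {n d : ℕ}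

/-- The derivations `∂/∂z_j` and `∂/∂s_t`, indexed together. -/
def zsDeriv : Fin n ⊕ Fin d → (DSp n d → ℂ) → DSp n d → ℂ := Sum.elim dwZ dwS

/-- `f` is smooth at `0` and all its derivatives of order at most `m` in the `z` and `s`
directions (but not `z̄`) vanish at `0`. -/
def ZSFlat : ℕ → (DSp n d → ℂ) → Prop
  | 0, f => SmoothAtZero f ∧ f 0 = 0
  | m + 1, f => SmoothAtZero f ∧ f 0 = 0 ∧ ∀ i, ZSFlat m (zsDeriv i f)

theorem exists_zsDeriv_eq_wirt (i : Fin n ⊕ Fin d) :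
    ∃ c c' v w, ∀ f : DSp n d → ℂ, zsDeriv i f = wirt c c' v w f := by
  cases i with
  | inl j => exact ⟨_, _, _, _, dwZ_eq_wirt j⟩
  | inr t => exact ⟨_, _, _, _, dwS_eq_wirt t⟩

theorem SmoothAtZero.dwZbar {f : DSp n d → ℂ} (hf : SmoothAtZero f) (j : Fin n) :
    SmoothAtZero (dwZbar j f) := by
  rw [dwZbar_eq_wirt]; exact hf.wirt _ _ _ _

theorem SmoothAtZero.dwS {f : DSp n d → ℂ} (hf : SmoothAtZero f) (t : Fin d) :
    SmoothAtZero (dwS t f) := by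
  rw [dwS_eq_wirt]; exact hf.wirt _ _ _ _

theorem SmoothAtZero.zsDeriv {f : DSp n d → ℂ} (hf : SmoothAtZero f) (i : Fin n ⊕ Fin d) :
    SmoothAtZero (zsDeriv i f) := by
  obtain ⟨c, c', v, w, h⟩ := exists_zsDeriv_eq_wirt i
  rw [h]; exact hf.wirt _ _ _ _

namespace ZSFlat

variable {m : ℕ} {f g : DSp n d → ℂ}

theorem smooth (h : ZSFlat m f) : SmoothAtZero f := by
  cases m with
  | zero => exact h.1
  | succ m => exact h.1

theorem apply_zero (h : ZSFlat m f) : f 0 = 0 := by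
  cases m with
  | zero => exact h.2
  | succ m => exact h.2.1

theorem of_succ (h : ZSFlat (m + 1) f) : ZSFlat m f := by
  induction m generalizing f with
  | zero => exact ⟨h.1, h.2.1⟩
  | succ m ih => exact ⟨h.1, h.2.1, fun i => ih (h.2.2 i)⟩

theorem mono {m' : ℕ} (h : ZSFlat m f) (hm : m' ≤ m) : ZSFlat m' f := by
  induction hm with
  | refl => exact h
  | step _ ih => exact ih h.of_succ

theorem dwZ (h : ZSFlat (m + 1) f) (j : Fin n) : ZSFlat m (dwZ j f) := h.2.2 (.inl j)

theorem dwS (h : ZSFlat (m + 1) f) (t : Fin d) : ZSFlat m (dwS t f) := h.2.2 (.inr t)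

theorem congr (h : ZSFlat m f) (hfg : f =ᶠ[𝓝 0] g) : ZSFlat m g := by
  induction m generalizing f g with
  | zero => exact ⟨h.1.congr_of_eventuallyEq hfg.symm, hfg.eq_of_nhds ▸ h.2⟩
  | succ m ih =>
    refine ⟨h.1.congr_of_eventuallyEq hfg.symm, hfg.eq_of_nhds ▸ h.2.1, fun i => ?_⟩
    refine ih (h.2.2 i) ?_
    obtain ⟨c, c', v, w, hi⟩ := exists_zsDeriv_eq_wirt i
    rw [hi, hi]
    exact wirt_congr hfg _ _ _ _

theorem zero : ZSFlat m (fun _ : DSp n d => (0 : ℂ)) := by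
  induction m with
  | zero => exact ⟨contDiffAt_const, rfl⟩
  | succ m ih =>
    refine ⟨contDiffAt_const, rfl, fun i => ?_⟩
    obtain ⟨c, c', v, w, hi⟩ := exists_zsDeriv_eq_wirt i
    rw [hi]
    exact ih.congr (.of_forall fun q => (wirt_const _ _ _ _ _ q).symm)

theorem add (hf : ZSFlat m f) (hg : ZSFlat m g) : ZSFlat m (fun q => f q + g q) := by
  induction m generalizing f g with
  | zero => exact ⟨hf.1.add hg.1, by simp [hf.2, hg.2]⟩
  | succ m ih =>
    refine ⟨hf.1.add hg.1, by simp [hf.2.1, hg.2.1], fun i => ?_⟩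
    refine (ih (hf.2.2 i) (hg.2.2 i)).congr ?_
    obtain ⟨c, c', v, w, hi⟩ := exists_zsDeriv_eq_wirt i
    filter_upwards [hf.1.eventually_differentiableAt, hg.1.eventually_differentiableAt]
      with q h1 h2
    rw [hi, hi, hi, wirt_add h1 h2]

theorem mul (hf : ZSFlat m f) (hg : SmoothAtZero g) : ZSFlat m (fun q => f q * g q) := by
  induction m generalizing f g with
  | zero => exact ⟨hf.1.mul hg, by simp [hf.2]⟩
  | succ m ih =>
    refine ⟨hf.1.mul hg, by simp [hf.2.1], fun i => ?_⟩
    refine ((ih (hf.2.2 i) hg).add (ih hf.of_succ (hg.zsDeriv i))).congr ?_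
    obtain ⟨c, c', v, w, hi⟩ := exists_zsDeriv_eq_wirt i
    filter_upwards [hf.1.eventually_differentiableAt, hg.eventually_differentiableAt]
      with q h1 h2
    rw [hi, hi, hi, wirt_mul h1 h2]

theorem const_mul (hf : ZSFlat m f) (a : ℂ) : ZSFlat m (fun q => a * f q) := by
  simpa only [mul_comm] using hf.mul (g := fun _ => a) contDiffAt_const

theorem neg (hf : ZSFlat m f) : ZSFlat m (fun q => -f q) := by
  simpa using hf.const_mul (-1)

theorem sub (hf : ZSFlat m f) (hg : ZSFlat m g) : ZSFlat m (fun q => f q - g q) := by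
  simpa only [sub_eq_add_neg] using hf.add hg.neg

theorem sum {ι : Type*} {s : Finset ι} {F : ι → DSp n d → ℂ} (h : ∀ i ∈ s, ZSFlat m (F i)) :
    ZSFlat m (fun q => ∑ i ∈ s, F i q) := by
  classical
  induction s using Finset.induction_on with
  | empty => simpa using zero
  | insert a s ha ih =>
    simp only [Finset.sum_insert ha]
    exact (h a (Finset.mem_insert_self _ _)).add
      (ih fun i hi => h i (Finset.mem_insert_of_mem hi))

end ZSFlat

theorem zsFlat_mixedDeriv {k : ℕ} {φ : DSp n d → Fin d → ℝ} (hjet : InJkNH n d k φ)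
    (t : Fin d) (hφ : Smooth fun q => (φ q t : ℂ)) (m : ℕ) (α : Fin n → ℕ) (γ : Fin d → ℕ)
    (hm : (∑ i, α i) + (∑ u, γ u) + m ≤ k) :
    ZSFlat m (mixedDeriv α 0 γ fun q => (φ q t : ℂ)) := by
  have hv : ∀ (α : Fin n → ℕ) (γ : Fin d → ℕ), (∑ i, α i) + (∑ u, γ u) ≤ k →
      mixedDeriv α 0 γ (fun q => (φ q t : ℂ)) 0 = 0 := fun α γ h =>
    hjet α 0 γ (by simpa using h) (.inr rfl) t
  induction m generalizing α γ with
  | zero => exact ⟨(smooth_mixedDeriv _ _ _ hφ).contDiffAt, hv _ _ (by omega)⟩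
  | succ m ih =>
    refine ⟨(smooth_mixedDeriv _ _ _ hφ).contDiffAt, hv _ _ (by omega), ?_⟩
    rintro (j | u)
    · change ZSFlat m (dwZ j _)
      have hs : (∑ i, (α + Pi.single j 1 : Fin n → ℕ) i) = (∑ i, α i) + 1 := by
        simp [Finset.sum_add_distrib]
      rw [dwZ_mixedDeriv _ _ _ hφ]
      exact ih _ _ (by omega)
    · change ZSFlat m (dwS u _)
      have hs : (∑ i, (γ + Pi.single u 1 : Fin d → ℕ) i) = (∑ i, γ i) + 1 := by
        simp [Finset.sum_add_distrib]
      rw [dwS_mixedDeriv _ _ _ hφ]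
      exact ih _ _ (by omega)

theorem InJkNH.zsFlat {k : ℕ} {φ : DSp n d → Fin d → ℝ} (hjet : InJkNH n d k φ)
    (t : Fin d) (hφ : Smooth fun q => (φ q t : ℂ)) : ZSFlat k fun q => (φ q t : ℂ) := by
  simpa only [mixedDeriv_zero] using zsFlat_mixedDeriv hjet t hφ k 0 0 (by simp)

end Flatness

section MatrixInverse

variable {E : Type*} [NormedAddCommGroup E] [NormedSpace ℝ E]

theorem SmoothAtZero.det {d : ℕ} {M : E → Matrix (Fin d) (Fin d) ℂ}
    (hM : ∀ u t, SmoothAtZero fun q => M q u t) : SmoothAtZero fun q => (M q).det := by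
  simp only [SmoothAtZero, Matrix.det_apply']
  exact ContDiffAt.sum fun σ _ => contDiffAt_const.mul (contDiffAt_prod fun i _ => hM _ _)

theorem SmoothAtZero.matrix_inv {d : ℕ} {M : E → Matrix (Fin d) (Fin d) ℂ}
    (hM : ∀ u t, SmoothAtZero fun q => M q u t) (h0 : (M 0).det ≠ 0) (u t : Fin d) :
    SmoothAtZero fun q => (M q)⁻¹ u t := by
  simp only [SmoothAtZero, Matrix.inv_def, Matrix.smul_apply, Ring.inverse_eq_inv',
    smul_eq_mul, Matrix.adjugate_apply]
  refine ((SmoothAtZero.det hM).inv h0).mul (SmoothAtZero.det fun a b => ?_)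
  by_cases hat : a = t
  · subst hat
    simpa only [SmoothAtZero, Matrix.updateRow_self] using contDiffAt_const
  · simpa only [Matrix.updateRow_ne hat] using hM a b

end MatrixInverse

section GraphFields

variable {n d : ℕ}

theorem fderiv_ofReal_comp {φ : DSp n d → Fin d → ℝ}
    (hφ : ContDiff ℝ ((⊤ : ℕ∞) : WithTop ℕ∞) φ) (t : Fin d) (q v : DSp n d) :
    fderiv ℝ (fun x => (φ x t : ℂ)) q v = (fderiv ℝ (fun x => φ x t) q v : ℝ) := by
  have h : DifferentiableAt ℝ (fun x => φ x t) q :=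
    ((contDiff_pi.mp hφ t).differentiable (by simp)) q
  have := (Complex.ofRealCLM.hasFDerivAt.comp q h.hasFDerivAt).fderiv
  change fderiv ℝ (Complex.ofRealCLM ∘ fun x => φ x t) q v = _
  rw [this]
  rfl

theorem conj_dwZ {φ : DSp n d → Fin d → ℝ} (hφ : ContDiff ℝ ((⊤ : ℕ∞) : WithTop ℕ∞) φ)
    (j : Fin n) (t : Fin d) (q : DSp n d) :
    starRingEnd ℂ (dwZ j (fun x => (φ x t : ℂ)) q) = dwZbar j (fun x => (φ x t : ℂ)) q := by
  simp [dwZ, dwZbar, fderiv_ofReal_comp hφ, Complex.conj_ofNat]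

theorem conj_dwS {φ : DSp n d → Fin d → ℝ} (hφ : ContDiff ℝ ((⊤ : ℕ∞) : WithTop ℕ∞) φ)
    (u t : Fin d) (q : DSp n d) :
    starRingEnd ℂ (dwS u (fun x => (φ x t : ℂ)) q) = dwS u (fun x => (φ x t : ℂ)) q := by
  simp [dwS, fderiv_ofReal_comp hφ]

theorem smooth_ofReal {φ : DSp n d → Fin d → ℝ} (hφ : ContDiff ℝ ((⊤ : ℕ∞) : WithTop ℕ∞) φ)
    (t : Fin d) : Smooth fun q => (φ q t : ℂ) :=
  Complex.ofRealCLM.contDiff.comp (contDiff_pi.mp hφ t)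

theorem SmoothAtZero.conj {E : Type*} [NormedAddCommGroup E] [NormedSpace ℝ E] {f : E → ℂ}
    (hf : SmoothAtZero f) : SmoothAtZero fun q => starRingEnd ℂ (f q) :=
  Complex.conjCLE.contDiff.contDiffAt.comp 0 hf

/-- The matrix `(id - i φ_s)⁻¹` appearing in the fields `L_j`. -/
def invMat (φ : DSp n d → Fin d → ℝ) (q : DSp n d) : Matrix (Fin d) (Fin d) ℂ :=
  (1 - Complex.I • phiSMat φ q)⁻¹

variable {k : ℕ} {φ : DSp n d → Fin d → ℝ}

theorem smooth_one_sub_phiSMat (hφ : ContDiff ℝ ((⊤ : ℕ∞) : WithTop ℕ∞) φ) (u t : Fin d) :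
    SmoothAtZero fun q => (1 - Complex.I • phiSMat φ q) u t := by
  simp only [SmoothAtZero, Matrix.sub_apply, Matrix.smul_apply, smul_eq_mul]
  exact contDiffAt_const.sub (contDiffAt_const.mul
    (smooth_dwS t _ (smooth_ofReal hφ u)).contDiffAt)

theorem det_one_sub_phiSMat_zero (hφ : ContDiff ℝ ((⊤ : ℕ∞) : WithTop ℕ∞) φ)
    (hjet : InJkNH n d (k + 1) φ) : (1 - Complex.I • phiSMat φ 0).det ≠ 0 := by
  have : phiSMat φ 0 = 0 := by
    ext u t
    exact ((hjet.zsFlat u (smooth_ofReal hφ u)).dwS t).apply_zero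
  simp [this]

theorem smooth_invMat (hφ : ContDiff ℝ ((⊤ : ℕ∞) : WithTop ℕ∞) φ)
    (hjet : InJkNH n d (k + 1) φ) (u t : Fin d) : SmoothAtZero fun q => invMat φ q u t :=
  SmoothAtZero.matrix_inv (smooth_one_sub_phiSMat hφ) (det_one_sub_phiSMat_zero hφ hjet) u t

theorem eventually_invMat_sub_one (hφ : ContDiff ℝ ((⊤ : ℕ∞) : WithTop ℕ∞) φ)
    (hjet : InJkNH n d (k + 1) φ) (u t : Fin d) :
    ∀ᶠ q in 𝓝 (0 : DSp n d), invMat φ q u t - (1 : Matrix (Fin d) (Fin d) ℂ) u t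
      = ∑ v, dwS t (fun x => (φ x v : ℂ)) q * (Complex.I * invMat φ q u v) := by
  have hc := (SmoothAtZero.det (smooth_one_sub_phiSMat hφ)).continuousAt
  filter_upwards [hc.eventually_ne (det_one_sub_phiSMat_zero hφ hjet)] with q hq
  have h : invMat φ q * (1 - Complex.I • phiSMat φ q) = 1 :=
    Matrix.nonsing_inv_mul _ (isUnit_iff_ne_zero.mpr hq)
  rw [mul_sub, mul_one, sub_eq_iff_eq_add] at h
  have h' : invMat φ q u t - (1 : Matrix (Fin d) (Fin d) ℂ) u t
      = (invMat φ q * Complex.I • phiSMat φ q) u t := by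
    conv_lhs => rw [h]
    simp
  rw [h', Matrix.mul_apply]
  refine Finset.sum_congr rfl fun v _ => ?_
  simp only [Matrix.smul_apply, smul_eq_mul, phiSMat]
  ring

theorem zsFlat_conj_invMat_sub_one (hφ : ContDiff ℝ ((⊤ : ℕ∞) : WithTop ℕ∞) φ)
    (hjet : InJkNH n d (k + 1) φ) (u t : Fin d) :
    ZSFlat k fun q => starRingEnd ℂ (invMat φ q u t)
      - (1 : Matrix (Fin d) (Fin d) ℂ) u t := by
  refine (ZSFlat.sum (s := Finset.univ) fun v _ =>
    ((hjet.zsFlat v (smooth_ofReal hφ v)).dwS t).mul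
      (contDiffAt_const (c := -Complex.I) |>.mul (smooth_invMat hφ hjet u v).conj)).congr ?_
  filter_upwards [eventually_invMat_sub_one hφ hjet u t] with q hq
  have := congrArg (starRingEnd ℂ) hq
  rw [map_sub, map_sum, Matrix.one_apply, apply_ite (starRingEnd ℂ), map_one, map_zero,
    ← Matrix.one_apply] at this
  rw [this]
  simp only [map_mul, conj_dwS hφ, Complex.conj_I]

theorem zsFlat_invMat_sub_one (hφ : ContDiff ℝ ((⊤ : ℕ∞) : WithTop ℕ∞) φ)
    (hjet : InJkNH n d (k + 1) φ) (u t : Fin d) :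
    ZSFlat k fun q => invMat φ q u t - (1 : Matrix (Fin d) (Fin d) ℂ) u t := by
  refine (ZSFlat.sum (s := Finset.univ) fun v _ =>
    ((hjet.zsFlat v (smooth_ofReal hφ v)).dwS t).mul
      (contDiffAt_const (c := Complex.I) |>.mul (smooth_invMat hφ hjet u v))).congr ?_
  filter_upwards [eventually_invMat_sub_one hφ hjet u t] with q hq using hq.symm

theorem zsFlat_graphLfield_c (hφ : ContDiff ℝ ((⊤ : ℕ∞) : WithTop ℕ∞) φ)
    (hjet : InJkNH n d (k + 1) φ) (j : Fin n) (t : Fin d) :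
    ZSFlat k fun q => (graphLfield φ j).c q t :=
  ZSFlat.sum (s := Finset.univ) (F := fun u q => Complex.I * dwZ j (fun x => (φ x u : ℂ)) q *
    invMat φ q u t) fun u _ => (((hjet.zsFlat u (smooth_ofReal hφ u)).dwZ j).const_mul _).mul
    (smooth_invMat hφ hjet u t)

theorem graphLfield_conj_c (hφ : ContDiff ℝ ((⊤ : ℕ∞) : WithTop ℕ∞) φ) (l : Fin n)
    (t : Fin d) (q : DSp n d) :
    (graphLfield φ l).conj.c q t = ∑ u, -Complex.I * dwZbar l (fun x => (φ x u : ℂ)) q *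
      starRingEnd ℂ (invMat φ q u t) := by
  simp only [GVF.conj, graphLfield, map_sum, map_mul, conj_dwZ hφ, Complex.conj_I, invMat]

theorem zsFlat_graphLfield_conj_c (hφ : ContDiff ℝ ((⊤ : ℕ∞) : WithTop ℕ∞) φ)
    (hjet : InJkNH n d (k + 1) φ) (l : Fin n) (t : Fin d) :
    ZSFlat k fun q => (graphLfield φ l).conj.c q t
      + Complex.I * dwZbar l (fun x => (φ x t : ℂ)) q := by
  refine (ZSFlat.sum (s := Finset.univ) fun u _ =>
    (zsFlat_conj_invMat_sub_one hφ hjet u t).mul (contDiffAt_const (c := -Complex.I) |>.mul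
      (smooth_dwZbar l _ (smooth_ofReal hφ u)).contDiffAt)).congr (.of_forall fun q => ?_)
  simp only [graphLfield_conj_c hφ, sub_mul, Finset.sum_sub_distrib, Matrix.one_apply]
  simp [mul_comm, mul_left_comm]

theorem smooth_graphLfield_conj_c (hφ : ContDiff ℝ ((⊤ : ℕ∞) : WithTop ℕ∞) φ)
    (hjet : InJkNH n d (k + 1) φ) (l : Fin n) (t : Fin d) :
    SmoothAtZero fun q => (graphLfield φ l).conj.c q t :=
  (zsFlat_graphLfield_c hφ hjet l t).smooth.conj

/-- The `z̄_l`-derivative of the coefficients of `L_j`, modulo flat functions. -/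
theorem zsFlat_dwZbar_graphLfield_c (hφ : ContDiff ℝ ((⊤ : ℕ∞) : WithTop ℕ∞) φ)
    (hjet : InJkNH n d (k + 1) φ) (j l : Fin n) (t : Fin d) :
    ZSFlat k fun q => dwZbar l (fun x => (graphLfield φ j).c x t) q
      - Complex.I * dwZ j (dwZbar l fun x => (φ x t : ℂ)) q := by
  have hZ : ∀ u, SmoothAtZero (dwZ j fun x => (φ x u : ℂ)) := fun u =>
    (smooth_dwZ j _ (smooth_ofReal hφ u)).contDiffAt
  have hB : ∀ u, SmoothAtZero fun q => Complex.I * invMat φ q u t := fun u =>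
    contDiffAt_const.mul (smooth_invMat hφ hjet u t)
  have hc : (fun x => (graphLfield φ j).c x t) = fun x =>
      ∑ u, dwZ j (fun y => (φ y u : ℂ)) x * (Complex.I * invMat φ x u t) := by
    funext x
    simp only [graphLfield, invMat]
    exact Finset.sum_congr rfl fun u _ => by ring
  refine (ZSFlat.sum (s := Finset.univ) fun u _ =>
    ((zsFlat_invMat_sub_one hφ hjet u t).mul (contDiffAt_const (c := Complex.I) |>.mul
      ((hZ u).dwZbar l))).add
    (((hjet.zsFlat u (smooth_ofReal hφ u)).dwZ j).mul ((hB u).dwZbar l))).congr ?_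
  filter_upwards [Filter.eventually_all.mpr fun u => (hZ u).eventually_differentiableAt,
    Filter.eventually_all.mpr fun u => (hB u).eventually_differentiableAt] with q h1 h2
  have hδ : Complex.I * dwZ j (dwZbar l fun x => (φ x t : ℂ)) q
      = ∑ u, (1 : Matrix (Fin d) (Fin d) ℂ) u t *
        (Complex.I * dwZbar l (dwZ j fun x => (φ x u : ℂ)) q) := by
    rw [← dwZbar_dwZ_comm l j _ (smooth_ofReal hφ t)]
    simp [Matrix.one_apply]
  rw [hδ, hc, dwZbar_eq_wirt, wirt_sum (s := Finset.univ)
    (F := fun u x => dwZ j (fun y => (φ y u : ℂ)) x * (Complex.I * invMat φ x u t))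
    fun u _ => (h1 u).mul (h2 u),
    ← Finset.sum_sub_distrib]
  refine Finset.sum_congr rfl fun u _ => ?_
  rw [wirt_mul (h1 u) (h2 u), ← dwZbar_eq_wirt, ← dwZbar_eq_wirt]
  ring

theorem act_graphLfield (j : Fin n) (f : DSp n d → ℂ) (q : DSp n d) :
    (graphLfield φ j).act f q = dwZ j f q + ∑ u, (graphLfield φ j).c q u * dwS u f q := by
  simp [GVF.act, graphLfield]

theorem act_graphLfield_conj (l : Fin n) (f : DSp n d → ℂ) (q : DSp n d) :
    (graphLfield φ l).conj.act f q
      = dwZbar l f q + ∑ u, (graphLfield φ l).conj.c q u * dwS u f q := by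
  simp [GVF.act, GVF.conj, graphLfield, apply_ite (starRingEnd ℂ)]

theorem act_const (v : GVF n d) (a : ℂ) (q : DSp n d) : v.act (fun _ => a) q = 0 := by
  simp [GVF.act, dwZ, dwZbar, dwS]

/-- Modulo flat functions, `L_j` acts as `∂/∂z_j`. -/
theorem zsFlat_act_graphLfield_sub (hφ : ContDiff ℝ ((⊤ : ℕ∞) : WithTop ℕ∞) φ)
    (hjet : InJkNH n d (k + 1) φ) (j : Fin n) {m : ℕ} (hm : m ≤ k) {f g : DSp n d → ℂ} {a : ℂ}
    (hf : SmoothAtZero f) (hg : SmoothAtZero g) (hfg : ZSFlat (m + 1) fun q => f q - a * g q) :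
    ZSFlat m fun q => (graphLfield φ j).act f q - a * dwZ j g q := by
  refine ((hfg.dwZ j).add (ZSFlat.sum (s := Finset.univ) fun u _ =>
    ((zsFlat_graphLfield_c hφ hjet j u).mono hm).mul (hf.dwS u))).congr ?_
  filter_upwards [hfg.smooth.eventually_differentiableAt, hg.eventually_differentiableAt]
    with q h1 h2
  have h := wirt_add h1 (h2.const_mul a) (1 / 2) (-(1 / 2) * Complex.I) (dez n d j) (dezI n d j)
  rw [wirt_mul (differentiableAt_const a) h2, wirt_const] at h
  simp only [sub_add_cancel, ← dwZ_eq_wirt] at h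
  rw [act_graphLfield, h]
  ring

theorem bracket_conj_a (j l : Fin n) :
    ((graphLfield φ j).bracket (graphLfield φ l).conj).a = fun _ _ => 0 := by
  funext q i
  simp [GVF.bracket, GVF.conj, graphLfield, act_const]

theorem bracket_conj_b (j l : Fin n) :
    ((graphLfield φ j).bracket (graphLfield φ l).conj).b = fun _ _ => 0 := by
  funext q i
  simp [GVF.bracket, GVF.conj, graphLfield, act_const]

theorem bracket_a_eq_zero (j : Fin n) {W : GVF n d} (ha : W.a = fun _ _ => 0) :
    ((graphLfield φ j).bracket W).a = fun _ _ => 0 := by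
  funext q i
  simp [GVF.bracket, graphLfield, act_const, ha]

theorem bracket_b_eq_zero (j : Fin n) {W : GVF n d} (hb : W.b = fun _ _ => 0) :
    ((graphLfield φ j).bracket W).b = fun _ _ => 0 := by
  funext q i
  simp [GVF.bracket, graphLfield, act_const, hb]

theorem zsFlat_bracket_conj_c (hφ : ContDiff ℝ ((⊤ : ℕ∞) : WithTop ℕ∞) φ) {m : ℕ}
    (hjet : InJkNH n d (m + 1 + 1) φ) (j l : Fin n) (t : Fin d) :
    ZSFlat m fun q => ((graphLfield φ j).bracket (graphLfield φ l).conj).c q t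
      - -2 * Complex.I * dwZ j (dwZbar l fun x => (φ x t : ℂ)) q := by
  have h1 := zsFlat_act_graphLfield_sub hφ hjet j (m := m) (by omega) (a := -Complex.I)
    (smooth_graphLfield_conj_c hφ hjet l t)
    (smooth_dwZbar l _ (smooth_ofReal hφ t)).contDiffAt
    ((zsFlat_graphLfield_conj_c hφ hjet l t).congr (.of_forall fun q => by ring))
  have h2 := (zsFlat_dwZbar_graphLfield_c hφ hjet j l t).of_succ
  have h3 : ZSFlat m fun q => ∑ u, dwS u (fun x => (graphLfield φ j).c x t) q *
      (graphLfield φ l).conj.c q u := ZSFlat.sum fun u _ =>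
    ((zsFlat_graphLfield_c hφ hjet j t).dwS u).mul (smooth_graphLfield_conj_c hφ hjet l u)
  refine (h1.sub (h2.add h3)).congr (.of_forall fun q => ?_)
  simp only [GVF.bracket, act_graphLfield_conj,
    fun u => mul_comm ((graphLfield φ l).conj.c q u)]
  ring

theorem zsFlat_bracket_c (hφ : ContDiff ℝ ((⊤ : ℕ∞) : WithTop ℕ∞) φ)
    (hjet : InJkNH n d (k + 1) φ) (j : Fin n) {m : ℕ} (hm : m + 1 ≤ k) {W : GVF n d}
    (ha : W.a = fun _ _ => 0) (hb : W.b = fun _ _ => 0) {g : Fin d → DSp n d → ℂ} {a : ℂ}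
    (hg : ∀ t, SmoothAtZero (g t)) (hW : ∀ t, ZSFlat (m + 1) fun q => W.c q t - a * g t q)
    (t : Fin d) :
    ZSFlat m fun q => ((graphLfield φ j).bracket W).c q t - a * dwZ j (g t) q := by
  have hc : ∀ t, SmoothAtZero fun q => W.c q t := fun t => by
    simpa [SmoothAtZero] using (hW t).smooth.add (contDiffAt_const (c := a) |>.mul (hg t))
  have h1 := zsFlat_act_graphLfield_sub hφ hjet j (by omega) (hc t) (hg t) (hW t)
  have h2 : ZSFlat m fun q => ∑ u, dwS u (fun x => (graphLfield φ j).c x t) q * W.c q u :=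
    ZSFlat.sum fun u _ => (((zsFlat_graphLfield_c hφ hjet j t).mono hm).dwS u).mul (hc u)
  refine (h1.sub h2).congr (.of_forall fun q => ?_)
  have hact : W.act (fun x => (graphLfield φ j).c x t) q
      = ∑ u, dwS u (fun x => (graphLfield φ j).c x t) q * W.c q u := by
    simp [GVF.act, ha, hb, mul_comm]
  simp only [GVF.bracket, hact]
  ring

theorem smooth_foldr_dwZ {f : DSp n d → ℂ} (hf : Smooth f) (js : List (Fin n)) :
    Smooth (js.foldr dwZ f) := by
  induction js with
  | nil => exact hf
  | cons j js ih => exact smooth_dwZ j _ ih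

theorem nestGVF_graphLfield (hφ : ContDiff ℝ ((⊤ : ℕ∞) : WithTop ℕ∞) φ)
    (hjet : InJkNH n d (k + 1) φ) (l : Fin n) (js : List (Fin n)) (hjs : js ≠ []) (m : ℕ)
    (hm : js.length + m = k) :
    (nestGVF (js.map (graphLfield φ)) (graphLfield φ l).conj).a = (fun _ _ => 0) ∧
    (nestGVF (js.map (graphLfield φ)) (graphLfield φ l).conj).b = (fun _ _ => 0) ∧
    ∀ t, ZSFlat m fun q => (nestGVF (js.map (graphLfield φ)) (graphLfield φ l).conj).c q t
      - -2 * Complex.I * js.foldr dwZ (dwZbar l fun x => (φ x t : ℂ)) q := by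
  induction js generalizing m with
  | nil => exact absurd rfl hjs
  | cons j js ih =>
    rw [List.length_cons] at hm
    rcases eq_or_ne js [] with rfl | hne
    · obtain rfl : k = m + 1 := by simp at hm; omega
      exact ⟨bracket_conj_a j l, bracket_conj_b j l, zsFlat_bracket_conj_c hφ hjet j l⟩
    · obtain ⟨ha, hb, hc⟩ := ih hne (m + 1) (by omega)
      exact ⟨bracket_a_eq_zero j ha, bracket_b_eq_zero j hb,
        zsFlat_bracket_c hφ hjet j (by omega) ha hb (fun t => (smooth_foldr_dwZ
          (smooth_dwZbar l _ (smooth_ofReal hφ t)) js).contDiffAt) hc⟩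

end GraphFields

theorem count_ofFn {ι : Type*} [DecidableEq ι] {r : ℕ} (js : Fin r → ι) (i : ι) :
    (List.ofFn js).count i = (Finset.univ.filter fun s => js s = i).card := by
  induction r with
  | zero => simp
  | succ r ih =>
    rw [List.ofFn_succ, List.count_cons, ih, Fin.card_filter_univ_succ]
    simp only [beq_iff_eq]
    split_ifs <;> simp

/-- **Identity (5.2) in Lemma 5.1.** For the basis `L_j` of `(1,0)` vector fields on the
graph `Im w = φ(z,z̄,s)` with `j^k_0 φ ∈ (J^k)_{nh}`, the iterated commutators satisfy
`[L_{j_1},[L_{j_2},…,[L_{j_r}, L̄_l]…]](0) = -2i φ_{z_{j_1}⋯z_{j_r} z̄_l}(0) ∂/∂s`. -/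
theorem iterated_commutator_identity
    (n d k : ℕ) (hn : 1 ≤ n) (hd : 1 ≤ d)
    (φ : DSp n d → Fin d → ℝ) (hφ : ContDiff ℝ (⊤ : ℕ∞) φ) (hjet : InJkNH n d k φ)
    (r : ℕ) (hr : 1 ≤ r) (hrk : r ≤ k - 1) (js : Fin r → Fin n) (l : Fin n) :
    (nestGVF (List.ofFn fun i => graphLfield φ (js i)) ((graphLfield φ l).conj)).a 0 = 0 ∧
    (nestGVF (List.ofFn fun i => graphLfield φ (js i)) ((graphLfield φ l).conj)).b 0 = 0 ∧
    (nestGVF (List.ofFn fun i => graphLfield φ (js i)) ((graphLfield φ l).conj)).c 0 =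
      fun t => (-2) * Complex.I *
        mixedDeriv (fun i => (Finset.univ.filter fun s => js s = i).card)
          (fun i => if i = l then 1 else 0) 0 (fun q => (φ q t : ℂ)) 0 := by
  obtain ⟨k, rfl⟩ : ∃ k', k = k' + 1 := ⟨k - 1, by omega⟩
  have hlist : (List.ofFn fun i => graphLfield φ (js i))
      = (List.ofFn js).map (graphLfield φ) := by
    rw [List.map_ofFn]; rfl
  have hne : List.ofFn js ≠ [] := fun h => by
    have := congrArg List.length h
    simp at this
    omega
  obtain ⟨ha, hb, hc⟩ := nestGVF_graphLfield hφ hjet l (List.ofFn js) hne (k - r)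
    (by rw [List.length_ofFn]; omega)
  rw [hlist, ha, hb]
  refine ⟨rfl, rfl, funext fun t => ?_⟩
  rw [sub_eq_zero.mp (hc t).apply_zero, foldr_dwZ_dwZbar (smooth_ofReal hφ t)]
  congr 2
  · exact funext fun i => count_ofFn js i
  · exact funext fun i => Pi.single_apply l 1 i
end
end

section
/- Let H¹ and H² be the Hermitian forms on ℂ³ with H¹(z,z) = |z₁|² − |z₂|² and H²(z,z) = 2·Re(z₁·z̄₃ + z₂·z̄₃). Then the joint kernel of the associated Hermitian 3×3 matrices is zero (i.e. the only vector v ∈ ℂ³ with H¹(v,·) = 0 and H²(v,·) = 0 is v = 0), yet for every (b₁,b₂) ∈ ℝ² the real linear combination b₁H¹ + b₂H² is a degenerate Hermitian form, i.e. has a nontrivial kernel. -/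
noncomputable section

open Complex Topology Manifold Set Function

/-- The Hermitian form on `ℂ³` associated with a Hermitian `3×3` matrix. -/
def hermForm (A : Matrix (Fin 3) (Fin 3) ℂ) (v u : Fin 3 → ℂ) : ℂ :=
  ∑ j, ∑ k, A j k * v j * starRingEnd ℂ (u k)

/-- The matrix of `H¹(z,z) = |z₁|² - |z₂|²`. -/
def matH1 : Matrix (Fin 3) (Fin 3) ℂ := Matrix.of ![![1, 0, 0], ![0, -1, 0], ![0, 0, 0]]
/-- The matrix of `H²(z,z) = 2 Re (z₁ z̄₃ + z₂ z̄₃)`. -/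
def matH2 : Matrix (Fin 3) (Fin 3) ℂ := Matrix.of ![![0, 0, 1], ![0, 0, 1], ![1, 1, 0]]

theorem hermForm_matH1 (v u : Fin 3 → ℂ) :
    hermForm matH1 v u = v 0 * starRingEnd ℂ (u 0) - v 1 * starRingEnd ℂ (u 1) := by
  simp [hermForm, matH1, Fin.sum_univ_three, sub_eq_add_neg]

theorem hermForm_matH2 (v u : Fin 3 → ℂ) :
    hermForm matH2 v u = v 0 * starRingEnd ℂ (u 2) + v 1 * starRingEnd ℂ (u 2) +
      v 2 * (starRingEnd ℂ (u 0) + starRingEnd ℂ (u 1)) := by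
  simp [hermForm, matH2, Fin.sum_univ_three]
  ring

/-- **A "null quadric" (Section 4).** The Hermitian forms `H¹(z,z) = |z₁|² - |z₂|²` and
`H²(z,z) = 2Re(z₁ z̄₃ + z₂ z̄₃)` on `ℂ³` have zero joint kernel, yet every real linear
combination `b₁H¹ + b₂H²` is a degenerate Hermitian form. -/
theorem null_quadric_example :
    (∀ z : Fin 3 → ℂ, hermForm matH1 z z =
      ((Complex.normSq (z 0) : ℂ) - (Complex.normSq (z 1) : ℂ))) ∧
    (∀ z : Fin 3 → ℂ, hermForm matH2 z z =
      (2 * (z 0 * starRingEnd ℂ (z 2) + z 1 * starRingEnd ℂ (z 2)).re : ℂ)) ∧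
    (∀ v : Fin 3 → ℂ, (∀ u, hermForm matH1 v u = 0) → (∀ u, hermForm matH2 v u = 0) →
      v = 0) ∧
    ∀ b₁ b₂ : ℝ, ∃ v : Fin 3 → ℂ, v ≠ 0 ∧
      ∀ u, (b₁ : ℂ) * hermForm matH1 v u + (b₂ : ℂ) * hermForm matH2 v u = 0 := by
  refine ⟨fun z => ?_, fun z => ?_, fun v h₁ h₂ => ?_, fun b₁ b₂ => ?_⟩
  · simp [hermForm_matH1, Complex.mul_conj]
  · rw [hermForm_matH2]
    apply Complex.ext <;> simp <;> ring
  · have h0 := h₁ (Pi.single 0 1)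
    have h1 := h₁ (Pi.single 1 1)
    have h2 := h₂ (Pi.single 0 1)
    simp only [hermForm_matH1, hermForm_matH2] at h0 h1 h2
    ext i
    fin_cases i <;> simp_all
  · by_cases hb : b₁ = 0 ∧ b₂ = 0
    · exact ⟨1, one_ne_zero, by simp [hb.1, hb.2]⟩
    · refine ⟨![(b₂ : ℂ), -b₂, -b₁], fun h => hb ⟨?_, ?_⟩, fun u => ?_⟩
      · simpa using congrFun h 2
      · simpa using congrFun h 0
      · simp only [hermForm_matH1, hermForm_matH2, Matrix.cons_val]
        ring
end
end
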